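/- arXiv:2004.09041 — 2 statements merged into one kernel-verified Lean document; each statement's English description precedes it below -/
import Mathlib

section
/- Let ν = a + b√3 ∈ O_K be totally positive and let v be the exponent of 𝔭₂ in the ideal (ν). If either v = 0 and b is even, or v = 2, then r_{2,K}(ν) = 4·σ_{0,χ}(ν). -/
/-!
Statements about sums of squares in K = ℚ(√3), with ring of integers O_K = ℤ[√3],
realized as `Zsqrtd 3`.
-/

noncomputable section

namespace Paper3

/-- π₂ = 1 + √3 in ℤ[√3]. -/
def pi2 : Zsqrtd 3 := ⟨1, 1⟩

/-- The real embedding of ℤ[√3] sending √3 to √3. -/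
def emb (x : Zsqrtd 3) : ℝ := (x.re : ℝ) + (x.im : ℝ) * Real.sqrt 3

/-- The real embedding of ℤ[√3] sending √3 to −√3. -/
def embConj (x : Zsqrtd 3) : ℝ := (x.re : ℝ) - (x.im : ℝ) * Real.sqrt 3

/-- An element of ℤ[√3] is totally positive if its images under both real embeddings
are positive. -/
def TotPos (x : Zsqrtd 3) : Prop := 0 < emb x ∧ 0 < embConj x

/-- `r2 ν` is the number of pairs (x₁,x₂) ∈ O_K² with x₁² + x₂² = ν. -/
def r2 (ν : Zsqrtd 3) : ℕ :=
  Set.ncard {t : Zsqrtd 3 × Zsqrtd 3 | t.1 ^ 2 + t.2 ^ 2 = ν}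

/-- The prime ideal 𝔭₂ = (π₂) of O_K, with (2) = 𝔭₂². -/
def p2 : Ideal (Zsqrtd 3) := Ideal.span {pi2}

open Classical in
/-- χ(𝔞) = sgn(N_{K/ℚ}(μ)) for a generator μ of a nonzero ideal 𝔞 coprime to 𝔭₂,
and χ(𝔞) = 0 for 𝔞 not coprime to 𝔭₂ (well defined since every unit has norm 1). -/
def chiIdeal (I : Ideal (Zsqrtd 3)) : ℤ :=
  if h : ∃ μ : Zsqrtd 3, I = Ideal.span {μ} then
    if I ⊔ p2 = ⊤ then Int.sign (Zsqrtd.norm h.choose) else 0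
  else 0

/-- σ_{0,χ}(ν) = Σ_{𝔞 ∣ (ν)} χ(𝔞), the sum over all nonzero ideals 𝔞 dividing (ν). -/
def sigmaChi (ν : Zsqrtd 3) : ℤ :=
  ∑ᶠ I ∈ {I : Ideal (Zsqrtd 3) | I ∣ Ideal.span {ν}}, chiIdeal I

/-- A domain with a Euclidean-type division by a natural-number-valued size is a
principal ideal ring. -/
theorem isPrincipalIdealRing_of_division {R : Type*} [CommRing R] (f : R → ℕ)
    (hf : ∀ a b : R, b ≠ 0 → ∃ q, f (a - b * q) < f b) : IsPrincipalIdealRing R := by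
  refine ⟨fun I => ?_⟩
  by_cases hI : I = ⊥
  · subst hI; infer_instance
  · have hne : {x | x ∈ I ∧ x ≠ 0}.Nonempty := by
      obtain ⟨x, hx, hx0⟩ := Submodule.exists_mem_ne_zero_of_ne_bot hI
      exact ⟨x, hx, hx0⟩
    obtain ⟨b, ⟨hb, hb0⟩, hmin⟩ := WellFounded.has_min (measure f).wf _ hne
    refine ⟨b, le_antisymm (fun a ha => ?_) ((Ideal.span_singleton_le_iff_mem I).2 hb)⟩
    obtain ⟨q, hq⟩ := hf a b hb0
    have h0 : a - b * q = 0 := by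
      by_contra h
      exact hmin _ ⟨I.sub_mem ha (I.mul_mem_right _ hb), h⟩ hq
    exact Ideal.mem_span_singleton.2 ⟨q, sub_eq_zero.1 h0⟩

theorem exists_near_multiple (n m : ℤ) (hn : 0 < n) : ∃ k : ℤ, |2 * (m - n * k)| ≤ n := by
  refine ⟨(2 * m + n) / (2 * n), ?_⟩
  have h1 := Int.mul_ediv_add_emod (2 * m + n) (2 * n)
  have h2 := Int.emod_nonneg (2 * m + n) (by lia : 2 * n ≠ 0)
  have h3 := Int.emod_lt_of_pos (2 * m + n) (by lia : 0 < 2 * n)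
  rw [abs_le]
  constructor <;> linarith

/-! ### The ring ℤ[√3] -/

theorem three_ne_mul_self (n : ℤ) : (3 : ℤ) ≠ n * n := by
  intro h
  have h1 : n < 2 := by nlinarith
  have h2 : -2 < n := by nlinarith
  interval_cases n <;> omega

theorem norm_eq_zero_iff {x : Zsqrtd 3} : x.norm = 0 ↔ x = 0 :=
  Zsqrtd.norm_eq_zero three_ne_mul_self x

instance : NoZeroDivisors (Zsqrtd 3) where
  eq_zero_or_eq_zero_of_mul_eq_zero {a b} h := by
    simpa [Zsqrtd.norm_mul, norm_eq_zero_iff] using congrArg Zsqrtd.norm h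

instance : IsDomain (Zsqrtd 3) := NoZeroDivisors.to_isDomain _

theorem norm_re_im (x : Zsqrtd 3) : x.norm = x.re ^ 2 - 3 * x.im ^ 2 := by
  rw [Zsqrtd.norm_def]; ring

instance : IsPrincipalIdealRing (Zsqrtd 3) := by
  refine isPrincipalIdealRing_of_division (fun x => x.norm.natAbs) fun a b hb => ?_
  have hn : b.norm ≠ 0 := fun h => hb (norm_eq_zero_iff.1 h)
  have hn' : 0 < |b.norm| := abs_pos.2 hn
  obtain ⟨k, hk⟩ := exists_near_multiple |b.norm| (a * star b).re hn'
  obtain ⟨l, hl⟩ := exists_near_multiple |b.norm| (a * star b).im hn'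
  obtain ⟨e, he⟩ : ∃ e : ℤ, |b.norm| = b.norm * e := by
    rcases abs_choice b.norm with h | h
    · exact ⟨1, by rw [h, mul_one]⟩
    · exact ⟨-1, by rw [h]; ring⟩
  refine ⟨⟨e * k, e * l⟩, ?_⟩
  have key : (a - b * ⟨e * k, e * l⟩) * star b =
      ⟨(a * star b).re - |b.norm| * k, (a * star b).im - |b.norm| * l⟩ := by
    rw [he]
    have := Zsqrtd.norm_def b
    ext
    · simp [Zsqrtd.norm_def]; ring
    · simp [Zsqrtd.norm_def]; ring
  have hN := congrArg Zsqrtd.norm key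
  rw [Zsqrtd.norm_mul, Zsqrtd.norm_conj, norm_re_im ⟨(a * star b).re - _, _⟩] at hN
  simp only at hN
  set u := (a * star b).re - |b.norm| * k
  set v := (a * star b).im - |b.norm| * l
  set m := (a - b * ⟨e * k, e * l⟩).norm
  have hu : (2 * u) ^ 2 ≤ |b.norm| ^ 2 := sq_le_sq' (by linarith [abs_le.1 hk]) (abs_le.1 hk).2
  have hv : (2 * v) ^ 2 ≤ |b.norm| ^ 2 := sq_le_sq' (by linarith [abs_le.1 hl]) (abs_le.1 hl).2
  have h2 : |m| * |b.norm| < |b.norm| * |b.norm| := by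
    rw [← abs_mul, hN, abs_lt]
    constructor <;> nlinarith [sq_nonneg u, sq_nonneg v]
  have := lt_of_mul_lt_mul_right h2 hn'.le
  zify
  exact this

theorem emb_mul_embConj {x : Zsqrtd 3} : emb x * embConj x = x.norm := by
  have h3 : Real.sqrt 3 ^ 2 = 3 := Real.sq_sqrt (by norm_num)
  rw [norm_re_im]
  simp only [emb, embConj]
  push_cast
  linear_combination (-(x.im : ℝ) ^ 2) * h3

theorem emb_mul (x y : Zsqrtd 3) : emb (x * y) = emb x * emb y := by
  have h3 : Real.sqrt 3 ^ 2 = 3 := Real.sq_sqrt (by norm_num)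
  simp only [emb, Zsqrtd.re_mul, Zsqrtd.im_mul]
  push_cast
  linear_combination (-(x.im * y.im : ℝ)) * h3

theorem embConj_mul (x y : Zsqrtd 3) : embConj (x * y) = embConj x * embConj y := by
  have h3 : Real.sqrt 3 ^ 2 = 3 := Real.sq_sqrt (by norm_num)
  simp only [embConj, Zsqrtd.re_mul, Zsqrtd.im_mul]
  push_cast
  linear_combination (-(x.im * y.im : ℝ)) * h3

theorem emb_add (x y : Zsqrtd 3) : emb (x + y) = emb x + emb y := by
  simp only [emb, Zsqrtd.re_add, Zsqrtd.im_add]; push_cast; ring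

theorem embConj_add (x y : Zsqrtd 3) : embConj (x + y) = embConj x + embConj y := by
  simp only [embConj, Zsqrtd.re_add, Zsqrtd.im_add]; push_cast; ring

theorem emb_neg (x : Zsqrtd 3) : emb (-x) = -emb x := by
  simp only [emb, Zsqrtd.re_neg, Zsqrtd.im_neg]; push_cast; ring

theorem embConj_neg (x : Zsqrtd 3) : embConj (-x) = -embConj x := by
  simp only [embConj, Zsqrtd.re_neg, Zsqrtd.im_neg]; push_cast; ring

theorem TotPos.norm_pos {x : Zsqrtd 3} (h : TotPos x) : 0 < x.norm := by
  have := mul_pos h.1 h.2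
  rw [emb_mul_embConj] at this
  exact_mod_cast this

theorem TotPos.re_pos {x : Zsqrtd 3} (h : TotPos x) : 0 < x.re := by
  have h1 := h.1
  have h2 := h.2
  simp only [emb, embConj] at h1 h2
  have : (0 : ℝ) < x.re := by linarith
  exact_mod_cast this

theorem TotPos.ne_zero {x : Zsqrtd 3} (h : TotPos x) : x ≠ 0 := by
  rintro rfl
  simpa using h.norm_pos

theorem TotPos.of_mul_left {x y : Zsqrtd 3} (hxy : TotPos (x * y)) (hx : TotPos x) :
    TotPos y := by
  rw [TotPos, emb_mul, embConj_mul] at hxy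
  exact ⟨(mul_pos_iff_of_pos_left hx.1).1 hxy.1, (mul_pos_iff_of_pos_left hx.2).1 hxy.2⟩

theorem totPos_or_neg {x : Zsqrtd 3} (h : 0 < x.norm) : TotPos x ∨ TotPos (-x) := by
  have h' : 0 < emb x * embConj x := by
    rw [emb_mul_embConj]; exact_mod_cast h
  rw [TotPos, TotPos, emb_neg, embConj_neg, neg_pos, neg_pos]
  exact mul_pos_iff.1 h'

theorem totPos_sq {x : Zsqrtd 3} (h : x ≠ 0) : TotPos (x * x) := by
  have hn : (x.norm : ℝ) ≠ 0 := by exact_mod_cast fun h0 => h (norm_eq_zero_iff.1 h0)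
  rw [← emb_mul_embConj] at hn
  rw [TotPos, emb_mul, embConj_mul]
  exact ⟨mul_self_pos.2 (left_ne_zero_of_mul hn), mul_self_pos.2 (right_ne_zero_of_mul hn)⟩

/-- Induction over the powers of the fundamental unit `2 + √3`. -/
theorem unit_induction {P : Zsqrtd 3 → Prop} (one : P 1)
    (mul_left : ∀ x, P x → P (⟨2, 1⟩ * x)) (mul_left' : ∀ x, P x → P (⟨2, -1⟩ * x))
    (x : Zsqrtd 3) (hx : x.norm = 1) (hre : 0 < x.re) : P x := by
  induction hn : x.im.natAbs using Nat.strong_induction_on generalizing x with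
  | _ n ih =>
    have hN := hx
    rw [norm_re_im] at hN
    rcases lt_trichotomy x.im 0 with h | h | h
    · have e : x = ⟨2, -1⟩ * (⟨2, 1⟩ * x) := by
        ext <;> simp <;> ring
      have h1 : -x.im < x.re := by nlinarith
      have h2 : x.re ≤ -2 * x.im := by nlinarith
      have h3 : 0 < 2 * x.re + 3 * x.im := by nlinarith
      rw [e]
      refine mul_left' _ (ih _ ?_ _ (by rw [Zsqrtd.norm_mul, hx]; rfl) (by simpa using h3) rfl)
      simp only [Zsqrtd.im_mul]
      lia
    · have : x = 1 := by
        ext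
        · rw [Zsqrtd.re_one]; nlinarith
        · simpa using h
      rwa [this]
    · have e : x = ⟨2, 1⟩ * (⟨2, -1⟩ * x) := by
        ext <;> simp <;> ring
      have h1 : x.im < x.re := by nlinarith
      have h2 : x.re ≤ 2 * x.im := by nlinarith
      have h3 : 0 < 2 * x.re - 3 * x.im := by nlinarith
      rw [e]
      refine mul_left _ (ih _ ?_ _ (by rw [Zsqrtd.norm_mul, hx]; rfl)
        (by simp; linarith) rfl)
      simp only [Zsqrtd.im_mul]
      lia

/-! ### Residue fields -/

theorem even_norm_iff (x : Zsqrtd 3) : Even x.norm ↔ Even (x.re + x.im) := by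
  rw [norm_re_im]
  simp [parity_simps]
  have h3 : ¬ Even (3 : ℤ) := by decide
  tauto

theorem norm_emod_four {x : Zsqrtd 3} (h : ¬ Even x.norm) : x.norm % 4 = 1 := by
  rw [even_norm_iff] at h
  rw [norm_re_im]
  rcases Int.even_or_odd' x.re with ⟨k, hk | hk⟩ <;> rcases Int.even_or_odd' x.im with ⟨l, hl | hl⟩
  · exact absurd ⟨k + l, by lia⟩ h
  · rw [hk, hl]; ring_nf; lia
  · rw [hk, hl]; ring_nf; lia
  · exact absurd ⟨k + l + 1, by lia⟩ h

def basisOneSqrt : Module.Basis (Fin 2) ℤ (Zsqrtd 3) :=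
  .ofEquivFun
    { toFun := fun x => ![x.re, x.im]
      invFun := fun v => ⟨v 0, v 1⟩
      map_add' := fun x y => by ext i; fin_cases i <;> simp
      map_smul' := fun n x => by ext i; fin_cases i <;> simp
      left_inv := fun x => by simp
      right_inv := fun v => by ext i; fin_cases i <;> simp }

instance : Module.Free ℤ (Zsqrtd 3) := .of_basis basisOneSqrt
instance : Module.Finite ℤ (Zsqrtd 3) := .of_basis basisOneSqrt

theorem algebra_norm_eq (x : Zsqrtd 3) : Algebra.norm ℤ x = x.norm := by
  rw [Algebra.norm_eq_matrix_det basisOneSqrt, Matrix.det_fin_two]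
  simp [Algebra.leftMulMatrix_eq_repr_mul, basisOneSqrt, Zsqrtd.norm_def]

/-- For an odd prime `π` of ℤ[√3], `-1` is a square modulo `π` exactly when `N(π) > 0`. -/
theorem exists_dvd_sq_add_one_iff {p : Zsqrtd 3} (hp : Prime p) (hodd : ¬ Even p.norm) :
    (∃ s, p ∣ s ^ 2 + 1) ↔ 0 < p.norm := by
  have hmax : (Ideal.span {p}).IsMaximal :=
    PrincipalIdealRing.isMaximal_of_irreducible hp.irreducible
  let _ := Ideal.Quotient.field (Ideal.span {p})
  have hcard : Nat.card (Zsqrtd 3 ⧸ Ideal.span {p}) = p.norm.natAbs := by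
    rw [← algebra_norm_eq, ← Ideal.absNorm_span_singleton, Ideal.absNorm_apply,
      Submodule.cardQuot_apply]
  have hn0 : p.norm ≠ 0 := fun h => hp.ne_zero (norm_eq_zero_iff.1 h)
  have : Finite (Zsqrtd 3 ⧸ Ideal.span {p}) :=
    Nat.finite_of_card_ne_zero (by rw [hcard]; exact Int.natAbs_ne_zero.2 hn0)
  let _ := Fintype.ofFinite (Zsqrtd 3 ⧸ Ideal.span {p})
  have hsq : (∃ s, p ∣ s ^ 2 + 1) ↔ IsSquare (-1 : Zsqrtd 3 ⧸ Ideal.span {p}) := by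
    constructor
    · rintro ⟨s, hs⟩
      refine ⟨Ideal.Quotient.mk _ s, ?_⟩
      rw [eq_comm, ← add_eq_zero_iff_eq_neg, ← map_mul, ← map_one (Ideal.Quotient.mk _), ← map_add,
        Ideal.Quotient.eq_zero_iff_mem, Ideal.mem_span_singleton, ← sq]
      exact hs
    · rintro ⟨t, ht⟩
      obtain ⟨s, rfl⟩ := Ideal.Quotient.mk_surjective t
      refine ⟨s, ?_⟩
      rw [← Ideal.mem_span_singleton, ← Ideal.Quotient.eq_zero_iff_mem, map_add, map_pow, map_one,
        sq, ← ht, neg_add_cancel]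
  rw [hsq, FiniteField.isSquare_neg_one_iff, ← Nat.card_eq_fintype_card, hcard]
  have := norm_emod_four hodd
  lia

/-! ### The ring ℤ[ζ₁₂] -/

/-- The ring ℤ[ζ₁₂] as the quadratic extension ℤ[√3][ω], where `ω² = √3 ω - 1`. -/
abbrev Cyc12 : Type := QuadraticAlgebra (Zsqrtd 3) (-1) Zsqrtd.sqrtd

/-- The relative norm from ℤ[ζ₁₂] to ℤ[√3]. -/
abbrev relNorm : Cyc12 →* Zsqrtd 3 := QuadraticAlgebra.norm

theorem relNorm_re (α : Cyc12) : 4 * (relNorm α).re =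
    (2 * α.re.re + 3 * α.im.im) ^ 2 + 3 * α.im.im ^ 2 +
      (2 * α.im.re + 3 * α.re.im) ^ 2 + 3 * α.re.im ^ 2 := by
  simp [QuadraticAlgebra.norm_def]; ring

theorem relNorm_eq (α : Cyc12) :
    relNorm α = α.re ^ 2 + Zsqrtd.sqrtd * α.re * α.im + α.im ^ 2 := by
  rw [QuadraticAlgebra.norm_def]; ring

theorem emb_relNorm_nonneg (α : Cyc12) : 0 ≤ emb (relNorm α) ∧ 0 ≤ embConj (relNorm α) := by
  have h3 : Real.sqrt 3 ^ 2 = 3 := Real.sq_sqrt (by norm_num)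
  have hs : emb Zsqrtd.sqrtd = √3 := by simp [emb]
  have hs' : embConj Zsqrtd.sqrtd = -√3 := by simp [embConj]
  rw [relNorm_eq]
  simp only [emb_add, embConj_add, sq, emb_mul, embConj_mul, hs, hs']
  constructor
  · nlinarith [sq_nonneg (2 * emb α.re + √3 * emb α.im), sq_nonneg (emb α.im)]
  · nlinarith [sq_nonneg (2 * embConj α.re - √3 * embConj α.im), sq_nonneg (embConj α.im)]

theorem relNorm_eq_zero_iff {α : Cyc12} : relNorm α = 0 ↔ α = 0 := by
  refine ⟨fun h => ?_, fun h => by rw [h]; simp⟩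
  have h4 := relNorm_re α
  rw [h, Zsqrtd.re_zero] at h4
  have h1 : α.im.im = 0 := by nlinarith [sq_nonneg (2 * α.re.re + 3 * α.im.im), sq_nonneg (2 * α.im.re + 3 * α.re.im), sq_nonneg α.im.im, sq_nonneg α.re.im]
  have h2 : α.re.im = 0 := by nlinarith [sq_nonneg (2 * α.re.re + 3 * α.im.im), sq_nonneg (2 * α.im.re + 3 * α.re.im), sq_nonneg α.im.im, sq_nonneg α.re.im]
  rw [h1, h2] at h4
  have h5 : α.re.re = 0 := by nlinarith [sq_nonneg α.re.re, sq_nonneg α.im.re]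
  have h6 : α.im.re = 0 := by nlinarith [sq_nonneg α.re.re, sq_nonneg α.im.re]
  ext <;> simpa

theorem totPos_relNorm {α : Cyc12} (h : α ≠ 0) : TotPos (relNorm α) := by
  have hn : ((relNorm α).norm : ℝ) ≠ 0 := by
    exact_mod_cast fun h0 => h (relNorm_eq_zero_iff.1 (norm_eq_zero_iff.1 h0))
  rw [← emb_mul_embConj] at hn
  exact ⟨(emb_relNorm_nonneg α).1.lt_of_ne' (left_ne_zero_of_mul hn),
    (emb_relNorm_nonneg α).2.lt_of_ne' (right_ne_zero_of_mul hn)⟩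

theorem abs_norm_relNorm_le (α : Cyc12) : |(relNorm α).norm| ≤ (relNorm α).re ^ 2 := by
  have : (0 : ℝ) ≤ (relNorm α).norm := by
    rw [← emb_mul_embConj]
    exact mul_nonneg (emb_relNorm_nonneg α).1 (emb_relNorm_nonneg α).2
  rw [abs_of_nonneg (by exact_mod_cast this), norm_re_im]
  nlinarith [sq_nonneg (relNorm α).im]

instance : NoZeroDivisors Cyc12 where
  eq_zero_or_eq_zero_of_mul_eq_zero {a b} h := by
    have := congrArg relNorm h
    rwa [map_mul, relNorm_eq_zero_iff.2 rfl, mul_eq_zero, relNorm_eq_zero_iff,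
      relNorm_eq_zero_iff] at this

instance : IsDomain Cyc12 := NoZeroDivisors.to_isDomain _

/-- Every element of ℤ[ζ₁₂] is close to a multiple of a given integer. -/
theorem exists_relNorm_sub_lt (c : Cyc12) (n : ℤ) (hn : 0 < n) :
    ∃ q : Cyc12, |(relNorm (c - (n : Cyc12) * q)).norm| < n ^ 4 := by
  obtain ⟨s, hs⟩ := exists_near_multiple n c.im.im hn
  obtain ⟨p, hp⟩ := exists_near_multiple (2 * n) (2 * c.re.re + 3 * (c.im.im - n * s)) (by lia)
  obtain ⟨q, hq⟩ := exists_near_multiple n c.re.im hn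
  obtain ⟨r, hr⟩ := exists_near_multiple (2 * n) (2 * c.im.re + 3 * (c.re.im - n * q)) (by lia)
  refine ⟨⟨⟨p, q⟩, ⟨r, s⟩⟩, (abs_norm_relNorm_le _).trans_lt ?_⟩
  set A := (relNorm (c - (n : Cyc12) * ⟨⟨p, q⟩, ⟨r, s⟩⟩)).re with hA
  have h4 := relNorm_re (c - (n : Cyc12) * ⟨⟨p, q⟩, ⟨r, s⟩⟩)
  rw [← hA] at h4
  simp only [QuadraticAlgebra.re_sub, QuadraticAlgebra.re_mul, QuadraticAlgebra.re_intCast,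
    QuadraticAlgebra.im_intCast, QuadraticAlgebra.im_sub, QuadraticAlgebra.im_mul, mul_zero,
    zero_mul, add_zero, Zsqrtd.re_sub, Zsqrtd.im_sub, Zsqrtd.re_mul, Zsqrtd.im_mul,
    Zsqrtd.re_intCast, Zsqrtd.im_intCast] at h4
  have e1 := sq_le_sq' (by linarith [abs_le.1 hs]) (abs_le.1 hs).2
  have e2 := sq_le_sq' (by linarith [abs_le.1 hp]) (abs_le.1 hp).2
  have e3 := sq_le_sq' (by linarith [abs_le.1 hq]) (abs_le.1 hq).2
  have e4 := sq_le_sq' (by linarith [abs_le.1 hr]) (abs_le.1 hr).2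
  have hA0 : 0 ≤ A := by
    have := relNorm_re (c - (n : Cyc12) * ⟨⟨p, q⟩, ⟨r, s⟩⟩)
    rw [← hA] at this
    nlinarith [sq_nonneg (c.im.im - n * s), sq_nonneg (c.re.im - n * q)]
  have hA1 : 8 * A ≤ 7 * n ^ 2 := by nlinarith
  have : 0 < n ^ 2 := by positivity
  nlinarith

instance : IsPrincipalIdealRing Cyc12 := by
  refine isPrincipalIdealRing_of_division (fun x => (relNorm x).norm.natAbs) fun a b hb => ?_
  have hn : 0 < (relNorm b).norm := (totPos_relNorm hb).norm_pos
  set b' : Cyc12 := star b * algebraMap _ _ (star (relNorm b)) with hb'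
  have hbb : b * b' = ((relNorm b).norm : Cyc12) := by
    rw [hb', ← mul_assoc, ← QuadraticAlgebra.algebraMap_norm_eq_mul_star, ← map_mul,
      ← Zsqrtd.norm_eq_mul_conj, map_intCast]
  obtain ⟨q, hq⟩ := exists_relNorm_sub_lt (a * b') _ hn
  refine ⟨q, ?_⟩
  have hN : (relNorm b).norm * (relNorm b').norm = (relNorm b).norm ^ 4 := by
    rw [← Zsqrtd.norm_mul, ← map_mul, hbb, QuadraticAlgebra.norm_intCast, sq, Zsqrtd.norm_mul,
      Zsqrtd.norm_intCast]
    ring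
  have hlt : |(relNorm (a - b * q)).norm| * |(relNorm b').norm| <
      |(relNorm b).norm| * |(relNorm b').norm| := by
    rw [← abs_mul, ← abs_mul, ← Zsqrtd.norm_mul, ← map_mul, hN, abs_of_pos (pow_pos hn 4)]
    rwa [show (a - b * q) * b' = a * b' - ((relNorm b).norm : Cyc12) * q by rw [← hbb]; ring]
  have := lt_of_mul_lt_mul_right hlt (abs_nonneg _)
  zify
  exact this

/-- A totally positive unit of ℤ[√3] is the norm of a unit of ℤ[ζ₁₂]. -/
theorem TotPos.exists_relNorm_eq {x : Zsqrtd 3} (hx : TotPos x) (hu : IsUnit x) :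
    ∃ η : Cyc12, relNorm η = x := by
  have h1 : x.norm = 1 := by
    have := hx.norm_pos
    have := Zsqrtd.norm_eq_one_iff.2 hu
    lia
  refine unit_induction (P := fun x => ∃ η : Cyc12, relNorm η = x) ⟨1, by simp⟩ ?_ ?_ x h1 hx.re_pos
  · rintro _ ⟨η, rfl⟩
    exact ⟨⟨1, 1⟩ * η, by rw [map_mul]; congr 1⟩
  · rintro _ ⟨η, rfl⟩
    exact ⟨⟨1, -1⟩ * η, by rw [map_mul]; congr 1⟩

/-- The square root `i = 2ω - √3` of `-1`. -/
def imagUnit : Cyc12 := ⟨-Zsqrtd.sqrtd, 2⟩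

theorem imagUnit_sq : imagUnit ^ 2 = -1 := by
  rw [sq]
  ext <;> simp [imagUnit, QuadraticAlgebra.re_one, QuadraticAlgebra.im_one]

theorem not_dvd_two {p : Zsqrtd 3} (hp : Prime p) (hodd : ¬ Even p.norm) : ¬ p ∣ 2 := by
  rintro ⟨c, hc⟩
  have h := congrArg Zsqrtd.norm hc
  rw [Zsqrtd.norm_mul, show (2 : Zsqrtd 3).norm = 4 from rfl] at h
  refine hp.not_isUnit (Zsqrtd.norm_eq_one_iff.1 ?_)
  have hcop : IsCoprime p.norm (2 ^ 2 : ℤ) := by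
    have : IsCoprime p.norm 2 := by
      rw [Int.not_even_iff_odd] at hodd
      obtain ⟨k, hk⟩ := hodd
      exact ⟨1, -k, by rw [hk]; ring⟩
    exact this.pow_right
  exact Int.isUnit_iff_natAbs_eq.1 (hcop.isUnit_of_dvd' dvd_rfl ⟨_, h⟩)

theorem exists_isUnit_eq_mul_of_mul_eq_sq {R : Type*} [CommRing R] [IsDomain R] {p x y : R}
    (hp : Prime p) (h : x * y = p ^ 2) (hx : ¬ IsUnit x) (hy : ¬ IsUnit y) :
    ∃ c, x = p * c ∧ IsUnit c := by
  rcases hp.dvd_or_dvd (⟨p, by rw [h, sq]⟩ : p ∣ x * y) with ⟨c, rfl⟩ | ⟨d, rfl⟩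
  · have h' : p = c * y := mul_left_cancel₀ hp.ne_zero (by rw [← sq, ← h, mul_assoc])
    exact ⟨c, rfl, (hp.irreducible.isUnit_or_isUnit h').resolve_right hy⟩
  · have h' : p = x * d := mul_left_cancel₀ hp.ne_zero (by rw [← sq, ← h]; ring)
    obtain ⟨u, rfl⟩ := (hp.irreducible.isUnit_or_isUnit h').resolve_left hx
    exact ⟨↑u⁻¹, by rw [h', mul_assoc, Units.mul_inv, mul_one], Units.isUnit _⟩

theorem exists_relNorm_eq_prime {p : Zsqrtd 3} (hp : Prime p) (hodd : ¬ Even p.norm)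
    (hpos : TotPos p) : ∃ P : Cyc12, relNorm P = p := by
  obtain ⟨s, hs⟩ := (exists_dvd_sq_add_one_iff hp hodd).2 hpos.norm_pos
  have hnd : ∀ x : Cyc12, x.im = 2 ∨ x.im = -2 → ¬ algebraMap _ Cyc12 p ∣ x := by
    rintro x hx h
    have h2 := (QuadraticAlgebra.algebraMap_dvd_iff.1 h).2
    refine not_dvd_two hp hodd ?_
    rcases hx with hx | hx
    · rwa [hx] at h2
    · rwa [hx, dvd_neg] at h2
  have hnp : ¬ Prime (algebraMap _ Cyc12 p) := by
    intro hP
    have : algebraMap _ Cyc12 p ∣ (algebraMap _ _ s + imagUnit) * (algebraMap _ _ s - imagUnit) := by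
      have e : (algebraMap _ _ s + imagUnit) * (algebraMap _ _ s - imagUnit) =
          algebraMap _ Cyc12 (s ^ 2 + 1) := by
        rw [map_add, map_pow, map_one]
        linear_combination -imagUnit_sq
      rw [e]
      exact map_dvd _ hs
    rcases hP.dvd_or_dvd this with h | h
    · exact hnd _ (by simp [imagUnit]) h
    · exact hnd _ (by simp [imagUnit]) h
  have hnu : ¬ IsUnit (algebraMap _ Cyc12 p) := by
    rw [QuadraticAlgebra.isUnit_iff_norm_isUnit, QuadraticAlgebra.norm_algebraMap,
      isUnit_pow_iff two_ne_zero]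
    exact hp.not_isUnit
  rw [← irreducible_iff_prime, irreducible_iff] at hnp
  push Not at hnp
  obtain ⟨A, B, hAB, hA, hB⟩ := hnp hnu
  have hN := congrArg relNorm hAB
  rw [map_mul, QuadraticAlgebra.norm_algebraMap] at hN
  rw [QuadraticAlgebra.isUnit_iff_norm_isUnit] at hA hB
  have hA0 : A ≠ 0 := by
    rintro rfl
    rw [zero_mul] at hAB
    exact hp.ne_zero ((QuadraticAlgebra.algebraMap_injective) (by rw [hAB, map_zero]))
  obtain ⟨c, hc, hcu⟩ : ∃ c, relNorm A = p * c ∧ IsUnit c :=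
    exists_isUnit_eq_mul_of_mul_eq_sq hp hN.symm hA hB
  have hd : TotPos c := (hc ▸ totPos_relNorm hA0 : TotPos (p * c)).of_mul_left hpos
  obtain ⟨u, rfl⟩ := hcu
  have hd' : TotPos (↑u⁻¹ : Zsqrtd 3) :=
    TotPos.of_mul_left (by rw [u.mul_inv, ← one_mul 1]; exact totPos_sq one_ne_zero) hd
  obtain ⟨η, hη⟩ := hd'.exists_relNorm_eq (Units.isUnit _)
  exact ⟨A * η, by rw [map_mul, hc, hη, mul_assoc, Units.mul_inv, mul_one]⟩

/-! ### Elements of ℤ[ζ₁₂] of given relative norm -/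

/-- The number of elements of ℤ[ζ₁₂] of relative norm `x`. -/
def normCount (x : Zsqrtd 3) : ℕ := {α : Cyc12 | relNorm α = x}.ncard

theorem finite_relNorm_eq (x : Zsqrtd 3) : {α : Cyc12 | relNorm α = x}.Finite := by
  let B := 4 * x.re
  have hfin := ((Set.finite_Icc (-B) B).prod (Set.finite_Icc (-B) B)).prod
    ((Set.finite_Icc (-B) B).prod (Set.finite_Icc (-B) B))
  refine (hfin.image fun t => (⟨⟨t.1.1, t.1.2⟩, ⟨t.2.1, t.2.2⟩⟩ : Cyc12)).subset ?_
  rintro α rfl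
  have h4 := relNorm_re α
  have key : ∀ u v : ℤ, (2 * u + 3 * v) ^ 2 + 3 * v ^ 2 ≤ B → u ∈ Set.Icc (-B) B ∧
      v ∈ Set.Icc (-B) B := by
    intro u v h
    have hu : u ^ 2 ≤ B := by nlinarith [sq_nonneg (u + 2 * v)]
    have hv : v ^ 2 ≤ B := by nlinarith [sq_nonneg (2 * u + 3 * v)]
    have hB : 0 ≤ B := (sq_nonneg v).trans hv
    refine ⟨⟨?_, ?_⟩, ?_, ?_⟩ <;> nlinarith
  obtain ⟨h1, h2⟩ := key α.re.re α.im.im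
    (by nlinarith [sq_nonneg (2 * α.im.re + 3 * α.re.im), sq_nonneg α.re.im])
  obtain ⟨h3, h5⟩ := key α.im.re α.re.im
    (by nlinarith [sq_nonneg (2 * α.re.re + 3 * α.im.im), sq_nonneg α.im.im])
  exact ⟨((α.re.re, α.re.im), (α.im.re, α.im.im)), ⟨⟨h1, h5⟩, h3, h2⟩, rfl⟩

theorem setOf_dvd_and_relNorm_eq {β : Cyc12} (hβ : β ≠ 0) (x : Zsqrtd 3) :
    {α : Cyc12 | β ∣ α ∧ relNorm α = relNorm β * x} = (β * ·) '' {α | relNorm α = x} := by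
  ext α
  constructor
  · rintro ⟨⟨γ, rfl⟩, h⟩
    rw [map_mul] at h
    exact ⟨γ, mul_left_cancel₀ (relNorm_eq_zero_iff.not.2 hβ) h, rfl⟩
  · rintro ⟨γ, rfl, rfl⟩
    exact ⟨dvd_mul_right _ _, map_mul _ _ _⟩

theorem ncard_dvd_and_relNorm_eq {β : Cyc12} (hβ : β ≠ 0) (x : Zsqrtd 3) :
    {α : Cyc12 | β ∣ α ∧ relNorm α = relNorm β * x}.ncard = normCount x := by
  rw [setOf_dvd_and_relNorm_eq hβ, Set.ncard_image_of_injective _ (mul_right_injective₀ hβ),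
    normCount]

theorem normCount_mul_of_forall_dvd {p : Zsqrtd 3} (hp : p ≠ 0) (x : Zsqrtd 3)
    (h : ∀ α : Cyc12, p ∣ relNorm α → algebraMap _ Cyc12 p ∣ α) :
    normCount (p * (p * x)) = normCount x := by
  have hp' : algebraMap _ Cyc12 p ≠ 0 :=
    fun h0 => hp (QuadraticAlgebra.algebraMap_injective (by rw [h0, map_zero]))
  rw [← ncard_dvd_and_relNorm_eq hp' x, normCount, QuadraticAlgebra.norm_algebraMap, sq, mul_assoc]
  congr 1
  ext α
  exact ⟨fun hα => ⟨h α ⟨_, hα⟩, hα⟩, fun hα => hα.2⟩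

theorem normCount_one : normCount 1 = 12 := by
  let S : Finset ((ℤ × ℤ) × (ℤ × ℤ)) :=
    ((Finset.Icc (-2) 2 ×ˢ Finset.Icc (-1) 1) ×ˢ (Finset.Icc (-2) 2 ×ˢ Finset.Icc (-1) 1)).filter
      fun t => relNorm ⟨⟨t.1.1, t.1.2⟩, ⟨t.2.1, t.2.2⟩⟩ = 1
  have hS : {α : Cyc12 | relNorm α = 1} =
      (fun t : (ℤ × ℤ) × (ℤ × ℤ) => (⟨⟨t.1.1, t.1.2⟩, ⟨t.2.1, t.2.2⟩⟩ : Cyc12)) '' S := by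
    ext α
    constructor
    · intro h
      refine ⟨((α.re.re, α.re.im), (α.im.re, α.im.im)), ?_, rfl⟩
      have h4 := relNorm_re α
      rw [h, Zsqrtd.re_one] at h4
      have key : ∀ u v : ℤ, (2 * u + 3 * v) ^ 2 + 3 * v ^ 2 ≤ 4 → (-2 ≤ u ∧ u ≤ 2) ∧
          (-1 ≤ v ∧ v ≤ 1) := by
        intro u v h
        have hu : u ^ 2 ≤ 4 := by nlinarith [sq_nonneg (u + 2 * v)]
        have hv : v ^ 2 < 4 := by nlinarith [sq_nonneg (2 * u + 3 * v)]
        have := abs_le_of_sq_le_sq' (by linarith : u ^ 2 ≤ 2 ^ 2) (by norm_num)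
        have := abs_lt_of_sq_lt_sq' (by linarith : v ^ 2 < 2 ^ 2) (by norm_num)
        lia
      have h1 := key α.re.re α.im.im
        (by nlinarith [sq_nonneg (2 * α.im.re + 3 * α.re.im), sq_nonneg α.re.im])
      have h2 := key α.im.re α.re.im
        (by nlinarith [sq_nonneg (2 * α.re.re + 3 * α.im.im), sq_nonneg α.im.im])
      simp only [S, Finset.coe_filter, Finset.mem_product, Finset.mem_Icc, Set.mem_ofPred_eq]
      exact ⟨⟨⟨h1.1, h2.2⟩, h2.1, h1.2⟩, h⟩
    · rintro ⟨t, ht, rfl⟩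
      exact (Finset.mem_filter.1 ht).2
  rw [normCount, hS, Set.ncard_image_of_injective, Set.ncard_coe_finset]
  · decide
  · rintro ⟨⟨p, q⟩, r, s⟩ ⟨⟨p', q'⟩, r', s'⟩ h
    simpa [QuadraticAlgebra.ext_iff, Zsqrtd.ext_iff, Prod.ext_iff] using h

theorem TotPos.normCount_of_isUnit {x : Zsqrtd 3} (hx : TotPos x) (hu : IsUnit x) :
    normCount x = 12 := by
  obtain ⟨η, rfl⟩ := hx.exists_relNorm_eq hu
  have hη : IsUnit η := QuadraticAlgebra.isUnit_iff_norm_isUnit.2 hu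
  rw [← normCount_one, ← ncard_dvd_and_relNorm_eq hη.ne_zero 1, normCount]
  congr 1
  ext α
  simp [hη.dvd]

theorem algebraMap_dvd_of_dvd_relNorm {p : Zsqrtd 3} (hp : Prime p) (hodd : ¬ Even p.norm)
    (hneg : p.norm < 0) (α : Cyc12) (h : p ∣ relNorm α) : algebraMap _ Cyc12 p ∣ α := by
  have h2 : ¬ p ∣ 2 := not_dvd_two hp hodd
  have hsq : p ∣ (2 * α.re + Zsqrtd.sqrtd * α.im) ^ 2 + α.im ^ 2 := by
    have h3 : Zsqrtd.sqrtd * Zsqrtd.sqrtd = (3 : Zsqrtd 3) := Zsqrtd.dmuld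
    have e : (2 * α.re + Zsqrtd.sqrtd * α.im) ^ 2 + α.im ^ 2 = relNorm α * 4 := by
      rw [relNorm_eq]; linear_combination α.im ^ 2 * h3
    rw [e]
    exact h.mul_right _
  have him : p ∣ α.im := by
    by_contra hnd
    obtain ⟨u, v, huv⟩ := (hp.irreducible.coprime_iff_not_dvd.2 hnd)
    refine hneg.not_gt ((exists_dvd_sq_add_one_iff hp hodd).1
      ⟨v * (2 * α.re + Zsqrtd.sqrtd * α.im), ?_⟩)
    have e : (v * (2 * α.re + Zsqrtd.sqrtd * α.im)) ^ 2 + 1 =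
        v ^ 2 * ((2 * α.re + Zsqrtd.sqrtd * α.im) ^ 2 + α.im ^ 2) + p * (u * (1 + v * α.im)) := by
      linear_combination (-1 - v * α.im) * huv
    rw [e]
    exact (hsq.mul_left _).add (dvd_mul_right _ _)
  refine QuadraticAlgebra.algebraMap_dvd_iff.2 ⟨?_, him⟩
  rw [relNorm_eq, sq α.im, dvd_add_left (him.mul_left _), dvd_add_left (him.mul_left _)] at h
  exact hp.dvd_of_dvd_pow h

theorem prime_of_relNorm_prime {P : Cyc12} (hp : Prime (relNorm P)) : Prime P := by
  refine Irreducible.prime ⟨fun h => hp.not_isUnit ?_, fun a b hab => ?_⟩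
  · exact QuadraticAlgebra.isUnit_iff_norm_isUnit.1 h
  · rw [QuadraticAlgebra.isUnit_iff_norm_isUnit, QuadraticAlgebra.isUnit_iff_norm_isUnit]
    refine hp.irreducible.isUnit_or_isUnit ?_
    rw [hab, map_mul]

theorem not_star_dvd_self {P : Cyc12} (hp : Prime (relNorm P)) : ¬ star P ∣ P := by
  intro h
  have hsub : P - star P = algebraMap _ Cyc12 P.im * imagUnit := by
    ext <;> simp [imagUnit] <;> ring
  have h1 : star P ∣ algebraMap _ Cyc12 P.im := by
    have h2 : star P ∣ algebraMap _ Cyc12 P.im * imagUnit := hsub ▸ dvd_sub h dvd_rfl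
    have e : algebraMap _ Cyc12 P.im = algebraMap _ Cyc12 P.im * imagUnit * -imagUnit := by
      linear_combination algebraMap _ Cyc12 P.im * imagUnit_sq
    rw [e]
    exact h2.mul_right _
  have him : relNorm P ∣ P.im := by
    have := map_dvd relNorm h1
    rw [QuadraticAlgebra.norm_star, QuadraticAlgebra.norm_algebraMap] at this
    exact hp.dvd_of_dvd_pow this
  have hre : relNorm P ∣ P.re := by
    have h3 : relNorm P ∣ P.re ^ 2 := by
      have e : P.re ^ 2 = relNorm P - P.im * (Zsqrtd.sqrtd * P.re + P.im) := by
        rw [relNorm_eq]; ring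
      rw [e]
      exact dvd_sub dvd_rfl (him.mul_right _)
    exact hp.dvd_of_dvd_pow h3
  obtain ⟨C, hC⟩ := QuadraticAlgebra.algebraMap_dvd_iff.2 ⟨hre, him⟩
  have hN := congrArg relNorm hC
  rw [map_mul, QuadraticAlgebra.norm_algebraMap, sq, mul_assoc] at hN
  exact hp.not_isUnit (.of_mul_eq_one (relNorm C) (mul_left_cancel₀ hp.ne_zero (by rw [← hN, mul_one])))

theorem normCount_mul_add {P : Cyc12} (hp : Prime (relNorm P)) (x : Zsqrtd 3) :
    normCount (relNorm P * x) + {γ : Cyc12 | relNorm P * relNorm γ = x}.ncard =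
      2 * normCount x := by
  have hP : Prime P := prime_of_relNorm_prime hp
  have hP' : Prime (star P) := prime_of_relNorm_prime (by rwa [QuadraticAlgebra.norm_star])
  have hPP : algebraMap _ Cyc12 (relNorm P) = P * star P :=
    QuadraticAlgebra.algebraMap_norm_eq_mul_star P
  have hpp : algebraMap _ Cyc12 (relNorm P) ≠ 0 := hPP ▸ mul_ne_zero hP.ne_zero hP'.ne_zero
  let S := {α : Cyc12 | P ∣ α ∧ relNorm α = relNorm P * x}
  let T := {α : Cyc12 | star P ∣ α ∧ relNorm α = relNorm (star P) * x}
  have hfin := finite_relNorm_eq (relNorm P * x)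
  have hun : {α : Cyc12 | relNorm α = relNorm P * x} = S ∪ T := by
    ext α
    constructor
    · intro hα
      have hd : P ∣ α * star α := by
        rw [← QuadraticAlgebra.algebraMap_norm_eq_mul_star]
        rw [show QuadraticAlgebra.norm α = _ from hα, map_mul, hPP, mul_assoc]
        exact dvd_mul_right _ _
      rcases hP.dvd_or_dvd hd with h | ⟨c, hc⟩
      · exact .inl ⟨h, hα⟩
      · refine .inr ⟨⟨star c, ?_⟩, by rw [QuadraticAlgebra.norm_star]; exact hα⟩
        rw [← star_star α, hc, star_mul, mul_comm]
    · rintro (h | ⟨-, h⟩)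
      · exact h.2
      · rwa [QuadraticAlgebra.norm_star] at h
  have hinter : S ∩ T = (algebraMap _ Cyc12 (relNorm P) * ·) ''
      {γ : Cyc12 | relNorm P * relNorm γ = x} := by
    ext α
    constructor
    · rintro ⟨⟨⟨β, rfl⟩, h⟩, hd, -⟩
      obtain ⟨γ, rfl⟩ := (hP'.dvd_or_dvd hd).resolve_left (not_star_dvd_self hp)
      refine ⟨γ, mul_left_cancel₀ hp.ne_zero ?_, by simp only [hPP, mul_assoc]⟩
      rw [← h, map_mul, map_mul, QuadraticAlgebra.norm_star]
    · rintro ⟨γ, rfl, rfl⟩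
      have hN : relNorm (algebraMap _ Cyc12 (relNorm P) * γ) =
          relNorm P * (relNorm P * relNorm γ) := by
        rw [map_mul, QuadraticAlgebra.norm_algebraMap, sq, mul_assoc]
      refine ⟨⟨?_, hN⟩, ?_, by rw [QuadraticAlgebra.norm_star]; exact hN⟩
      · simp only [hPP, mul_assoc]; exact dvd_mul_right _ _
      · simp only [hPP]; exact (dvd_mul_left _ _).mul_right _
  have hSfin : S.Finite := hfin.subset (hun ▸ Set.subset_union_left)
  have hTfin : T.Finite := hfin.subset (hun ▸ Set.subset_union_right)
  have := Set.ncard_union_add_ncard_inter S T hSfin hTfin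
  rw [← hun, hinter, Set.ncard_image_of_injective _ (mul_right_injective₀ hpp),
    ncard_dvd_and_relNorm_eq hP.ne_zero, ncard_dvd_and_relNorm_eq hP'.ne_zero] at this
  rw [normCount, this, two_mul]

/-! ### The divisor sum -/

theorem pi2_dvd_iff (x : Zsqrtd 3) : pi2 ∣ x ↔ Even (x.re + x.im) := by
  constructor
  · rintro ⟨y, rfl⟩
    exact ⟨y.re + 2 * y.im, by simp [pi2]; ring⟩
  · rintro ⟨k, hk⟩
    exact ⟨⟨2 * x.im - k, k - x.im⟩, by ext <;> simp [pi2] <;> lia⟩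

theorem prime_pi2 : Prime pi2 := by
  refine Irreducible.prime ⟨fun h => ?_, fun a b hab => ?_⟩
  · exact absurd (Zsqrtd.norm_eq_one_iff.2 h) (by decide)
  · have h := congrArg (fun x => x.norm.natAbs) hab
    simp only [Zsqrtd.norm_mul, Int.natAbs_mul] at h
    rw [← Zsqrtd.norm_eq_one_iff, ← Zsqrtd.norm_eq_one_iff, ← Nat.isUnit_iff, ← Nat.isUnit_iff]
    exact (Nat.prime_two.prime.irreducible).isUnit_or_isUnit h

theorem norm_eq_one_of_isUnit {u : Zsqrtd 3} (hu : IsUnit u) : u.norm = 1 := by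
  have h := (Zsqrtd.isUnit_iff_norm_isUnit u).1 hu
  have h4 := norm_emod_four (x := u)
  rcases Int.isUnit_iff.1 h with h | h
  · exact h
  · exact absurd (h4 (by rw [h]; decide)) (by rw [h]; decide)

/-- The character `χ` on elements. -/
def chiElt (x : Zsqrtd 3) : ℤ := if Even x.norm then 0 else Int.sign x.norm

theorem chiElt_mul (x y : Zsqrtd 3) : chiElt (x * y) = chiElt x * chiElt y := by
  simp only [chiElt, Zsqrtd.norm_mul, Int.even_mul, Int.sign_mul]
  split_ifs <;> simp_all

theorem chiIdeal_span (x : Zsqrtd 3) : chiIdeal (Ideal.span {x}) = chiElt x := by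
  have h : ∃ μ : Zsqrtd 3, Ideal.span {x} = Ideal.span {μ} := ⟨x, rfl⟩
  have hcop : Ideal.span {x} ⊔ p2 = ⊤ ↔ ¬ Even x.norm := by
    rw [← Ideal.isCoprime_iff_sup_eq, p2, Ideal.isCoprime_span_singleton_iff, isCoprime_comm,
      prime_pi2.irreducible.coprime_iff_not_dvd, pi2_dvd_iff, even_norm_iff]
  have hnorm : h.choose.norm = x.norm := by
    obtain ⟨u, hu⟩ := Ideal.span_singleton_eq_span_singleton.1 h.choose_spec
    rw [← hu, Zsqrtd.norm_mul, norm_eq_one_of_isUnit u.isUnit, mul_one]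
  rw [chiIdeal, dif_pos h, hnorm, chiElt]
  simp only [hcop, ite_not]

theorem chiIdeal_span_mul (x : Zsqrtd 3) (I : Ideal (Zsqrtd 3)) :
    chiIdeal (Ideal.span {x} * I) = chiElt x * chiIdeal I := by
  obtain ⟨y, rfl⟩ : ∃ y, I = Ideal.span {y} := (IsPrincipalIdealRing.principal I).principal
  rw [Ideal.span_singleton_mul_span_singleton, chiIdeal_span, chiIdeal_span, chiElt_mul]

theorem finite_dvd_span {x : Zsqrtd 3} (hx : x ≠ 0) :
    {I : Ideal (Zsqrtd 3) | I ∣ Ideal.span {x}}.Finite := by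
  have := UniqueFactorizationMonoid.fintypeSubtypeDvd (Ideal.span {x})
    (by simpa [Ideal.zero_eq_bot] using hx)
  exact Set.finite_coe_iff.1 (Finite.of_fintype {I // I ∣ Ideal.span {x}})

theorem sigmaChi_mul_add {p x : Zsqrtd 3} (hp : Prime p) (hx : x ≠ 0) :
    sigmaChi (p * x) + chiElt p *
      ∑ᶠ J ∈ {J : Ideal (Zsqrtd 3) | Ideal.span {p} * J ∣ Ideal.span {x}}, chiIdeal J =
      (1 + chiElt p) * sigmaChi x := by
  have hP : Prime (Ideal.span {p}) := Ideal.prime_span_singleton_iff.2 hp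
  have hinj : Function.Injective (Ideal.span {p} * ·) := mul_right_injective₀ hP.ne_zero
  let S := {I : Ideal (Zsqrtd 3) | I ∣ Ideal.span {x}}
  let T := (Ideal.span {p} * ·) '' S
  have hfin : S.Finite := finite_dvd_span hx
  have hun : {I : Ideal (Zsqrtd 3) | I ∣ Ideal.span {p * x}} = S ∪ T := by
    rw [← Ideal.span_singleton_mul_span_singleton]
    ext I
    constructor
    · intro hI
      by_cases hpI : Ideal.span {p} ∣ I
      · obtain ⟨J, rfl⟩ := hpI
        exact .inr ⟨J, (mul_dvd_mul_iff_left hP.ne_zero).1 hI, rfl⟩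
      · obtain ⟨J, hJ⟩ := hI
        obtain ⟨J', rfl⟩ := (hP.dvd_or_dvd ⟨_, hJ.symm⟩).resolve_left hpI
        exact .inl ⟨J', mul_left_cancel₀ hP.ne_zero (by rw [hJ]; exact mul_left_comm _ _ _)⟩
    · rintro (h | ⟨J, hJ, rfl⟩)
      · exact Dvd.dvd.mul_left h _
      · exact mul_dvd_mul_left _ hJ
  have hinter : S ∩ T = (Ideal.span {p} * ·) ''
      {J : Ideal (Zsqrtd 3) | Ideal.span {p} * J ∣ Ideal.span {x}} := by
    ext I
    constructor
    · rintro ⟨hI, J, -, rfl⟩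
      exact ⟨J, hI, rfl⟩
    · rintro ⟨J, hJ, rfl⟩
      exact ⟨hJ, J, (dvd_mul_left _ _).trans hJ, rfl⟩
  have := finsum_mem_union_inter (f := chiIdeal) hfin (hfin.image (Ideal.span {p} * ·))
  rw [← hun, hinter, finsum_mem_image hinj.injOn, finsum_mem_image hinj.injOn] at this
  simp only [chiIdeal_span_mul] at this
  rw [← mul_finsum_mem, ← mul_finsum_mem] at this
  rw [add_mul, one_mul]
  exact this

theorem sigmaChi_mul_of_not_dvd {p x : Zsqrtd 3} (hp : Prime p) (hx : x ≠ 0) (h : ¬ p ∣ x) :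
    sigmaChi (p * x) = (1 + chiElt p) * sigmaChi x := by
  have he : {J : Ideal (Zsqrtd 3) | Ideal.span {p} * J ∣ Ideal.span {x}} = ∅ := by
    refine Set.eq_empty_iff_forall_notMem.2 fun J hJ => h ?_
    rw [← Ideal.span_singleton_dvd_span_singleton_iff_dvd]
    exact (dvd_mul_right _ _).trans hJ
  rw [← sigmaChi_mul_add hp hx, he, finsum_mem_empty, mul_zero, add_zero]

theorem sigmaChi_mul_mul {p x : Zsqrtd 3} (hp : Prime p) (hx : x ≠ 0) :
    sigmaChi (p * (p * x)) + chiElt p * sigmaChi x = (1 + chiElt p) * sigmaChi (p * x) := by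
  have hP : Prime (Ideal.span {p}) := Ideal.prime_span_singleton_iff.2 hp
  have he : {J : Ideal (Zsqrtd 3) | Ideal.span {p} * J ∣ Ideal.span {p * x}} =
      {J | J ∣ Ideal.span {x}} := by
    ext J
    rw [← Ideal.span_singleton_mul_span_singleton]
    exact mul_dvd_mul_iff_left hP.ne_zero
  rw [← sigmaChi_mul_add hp (mul_ne_zero hp.ne_zero hx), he]
  rfl

theorem sigmaChi_of_isUnit {x : Zsqrtd 3} (hx : IsUnit x) : sigmaChi x = 1 := by
  have he : {I : Ideal (Zsqrtd 3) | I ∣ Ideal.span {x}} = {Ideal.span {1}} := by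
    ext I
    rw [Ideal.span_singleton_eq_top.2 hx, Ideal.span_singleton_one]
    show I ∣ ⊤ ↔ I = ⊤
    rw [← Ideal.isUnit_iff, ← Ideal.one_eq_top, isUnit_iff_dvd_one]
  rw [sigmaChi, he, finsum_mem_singleton, chiIdeal_span]
  decide

theorem sigmaChi_pi2_mul {x : Zsqrtd 3} (hx : x ≠ 0) : sigmaChi (pi2 * x) = sigmaChi x := by
  have h := sigmaChi_mul_add prime_pi2 hx
  rw [show chiElt pi2 = 0 by decide] at h
  linarith

/-- The number of elements of ℤ[ζ₁₂] with a given odd totally positive relative norm. -/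
theorem normCount_eq (x : Zsqrtd 3) (hx : TotPos x) (hodd : ¬ Even x.norm) :
    (normCount x : ℤ) = 12 * sigmaChi x := by
  induction hn : x.norm.natAbs using Nat.strong_induction_on generalizing x with
  | _ n ih =>
    subst hn
    by_cases hu : IsUnit x
    · rw [hx.normCount_of_isUnit hu, sigmaChi_of_isUnit hu]; rfl
    obtain ⟨p, hpi, m, rfl⟩ := WfDvdMonoid.exists_irreducible_factor hu hx.ne_zero
    have hlt : ∀ q y : Zsqrtd 3, ¬ IsUnit q → q * y ≠ 0 →
        y.norm.natAbs < (q * y).norm.natAbs := by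
      intro q y hq hqy
      rw [Zsqrtd.norm_mul, Int.natAbs_mul]
      rw [← Zsqrtd.norm_eq_one_iff] at hq
      have h1 : q.norm.natAbs ≠ 0 := by
        rw [Int.natAbs_ne_zero, Ne, norm_eq_zero_iff]; exact left_ne_zero_of_mul hqy
      have h2 : y.norm.natAbs ≠ 0 := by
        rw [Int.natAbs_ne_zero, Ne, norm_eq_zero_iff]; exact right_ne_zero_of_mul hqy
      exact lt_mul_of_one_lt_left (by lia) (by lia)
    rcases lt_or_ge 0 p.norm with hpos | hneg
    · obtain ⟨q, k, hqk, hq, hqp⟩ : ∃ q k, p * m = q * k ∧ Prime q ∧ TotPos q := by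
        rcases totPos_or_neg hpos with h | h
        · exact ⟨p, m, rfl, hpi.prime, h⟩
        · exact ⟨-p, -m, (neg_mul_neg p m).symm, hpi.prime.neg, h⟩
      rw [hqk] at hx hodd ih hu ⊢
      clear hqk hpos hpi m p
      have hodd' := hodd
      rw [Zsqrtd.norm_mul, Int.even_mul, not_or] at hodd'
      have hk := hx.of_mul_left hqp
      have hchi : chiElt q = 1 := by
        rw [chiElt, if_neg hodd'.1, Int.sign_eq_one_of_pos hqp.norm_pos]
      have ihk := ih _ (hlt q k hq.not_isUnit hx.ne_zero) k hk hodd'.2 rfl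
      obtain ⟨P, rfl⟩ := exists_relNorm_eq_prime hq hodd'.1 hqp
      have hcount := normCount_mul_add hq k
      by_cases hd : relNorm P ∣ k
      · obtain ⟨l, rfl⟩ := hd
        have hl := hk.of_mul_left hqp
        have hodd'' := hodd'.2
        rw [Zsqrtd.norm_mul, Int.even_mul, not_or] at hodd''
        have ihl := ih _ ((hlt _ l hq.not_isUnit hk.ne_zero).trans
          (hlt _ _ hq.not_isUnit hx.ne_zero)) l hl hodd''.2 rfl
        have e : {γ : Cyc12 | relNorm P * relNorm γ = relNorm P * l}.ncard = normCount l := by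
          simp only [mul_right_inj' hq.ne_zero, normCount]
        have hs := sigmaChi_mul_mul hq hl.ne_zero
        rw [hchi] at hs
        rw [e] at hcount
        zify at hcount
        linarith
      · have e : {γ : Cyc12 | relNorm P * relNorm γ = k} = ∅ :=
          Set.eq_empty_iff_forall_notMem.2 fun γ hγ => hd ⟨_, Eq.symm hγ⟩
        rw [e, Set.ncard_empty] at hcount
        have hs := sigmaChi_mul_of_not_dvd hq hk.ne_zero hd
        rw [hchi] at hs
        zify at hcount
        linarith
    · have hp := hpi.prime
      have hodd' := hodd
      rw [Zsqrtd.norm_mul, Int.even_mul, not_or] at hodd'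
      have hneg' : p.norm < 0 := hneg.lt_of_ne fun h => hp.ne_zero (norm_eq_zero_iff.1 h)
      have hchi : chiElt p = -1 := by
        rw [chiElt, if_neg hodd'.1, Int.sign_eq_neg_one_of_neg hneg']
      have hdvd := algebraMap_dvd_of_dvd_relNorm hp hodd'.1 hneg'
      have hm0 : m ≠ 0 := right_ne_zero_of_mul hx.ne_zero
      by_cases hd : p ∣ m
      · obtain ⟨k, rfl⟩ := hd
        have hk : TotPos k := by
          rw [← mul_assoc] at hx
          exact hx.of_mul_left (totPos_sq hp.ne_zero)
        have hodd'' := hodd'.2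
        rw [Zsqrtd.norm_mul, Int.even_mul, not_or] at hodd''
        have ihk := ih _ ((hlt _ k hp.not_isUnit hm0).trans
          (hlt _ _ hp.not_isUnit hx.ne_zero)) k hk hodd''.2 rfl
        have hs := sigmaChi_mul_mul hp hk.ne_zero
        rw [hchi] at hs
        rw [normCount_mul_of_forall_dvd hp.ne_zero k hdvd]
        linarith
      · have e : {α : Cyc12 | relNorm α = p * m} = ∅ := by
          refine Set.eq_empty_iff_forall_notMem.2 fun α hα => hd ?_
          have hα' : relNorm α = p * m := hα
          obtain ⟨γ, rfl⟩ := hdvd α ⟨_, hα'⟩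
          rw [map_mul, QuadraticAlgebra.norm_algebraMap, sq, mul_assoc] at hα'
          exact ⟨_, (mul_left_cancel₀ hp.ne_zero hα').symm⟩
        rw [normCount, e, Set.ncard_empty, sigmaChi_mul_of_not_dvd hp hm0 hd, hchi]
        simp

/-! ### From ℤ[ζ₁₂] to ℤ[√3][i] -/

/-- The primitive cube root of unity `ω⁴ = √3 ω - 2`. -/
def cubeRoot : Cyc12 := ⟨-2, Zsqrtd.sqrtd⟩

theorem relNorm_cubeRoot : relNorm cubeRoot = 1 := by
  ext <;> simp [relNorm_eq, cubeRoot, sq]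

theorem cubeRoot_pow_three : cubeRoot * (cubeRoot * cubeRoot) = 1 := by
  ext <;> simp [cubeRoot, QuadraticAlgebra.re_one, QuadraticAlgebra.im_one]

theorem r2_eq_ncard (ν : Zsqrtd 3) : r2 ν = {α : Cyc12 | relNorm α = ν ∧ 2 ∣ α.im}.ncard := by
  let f : Zsqrtd 3 × Zsqrtd 3 → Cyc12 := fun t => ⟨t.1 - Zsqrtd.sqrtd * t.2, 2 * t.2⟩
  have h3 : Zsqrtd.sqrtd * Zsqrtd.sqrtd = (3 : Zsqrtd 3) := Zsqrtd.dmuld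
  have hN : ∀ t, relNorm (f t) = t.1 ^ 2 + t.2 ^ 2 := by
    intro t
    rw [relNorm_eq]
    linear_combination (-t.2 ^ 2) * h3
  have hinj : Function.Injective f := by
    rintro ⟨a, b⟩ ⟨c, d⟩ h
    rw [QuadraticAlgebra.ext_iff] at h
    have h2 : b = d := mul_left_cancel₀ two_ne_zero h.2
    subst h2
    exact Prod.ext (sub_left_injective h.1) rfl
  rw [r2, ← Set.ncard_image_of_injective _ hinj]
  congr 1
  ext α
  constructor
  · rintro ⟨t, ht, rfl⟩
    exact ⟨(hN t).trans ht, dvd_mul_right _ _⟩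
  · rintro ⟨h, y, hy⟩
    have e : f (α.re + Zsqrtd.sqrtd * y, y) = α := by
      ext1
      · simp [f]
      · exact hy.symm
    exact ⟨_, (hN _).symm.trans (by rw [e, h]), e⟩

theorem two_dvd_iff (x : Zsqrtd 3) : 2 ∣ x ↔ Even x.re ∧ Even x.im := by
  rw [even_iff_two_dvd, even_iff_two_dvd, ← Zsqrtd.intCast_dvd]
  rfl

theorem cubeRoot_mul_im (α : Cyc12) :
    (cubeRoot * α).im = ⟨3 * α.re.im + α.im.re, α.re.re + α.im.im⟩ := by
  ext <;> simp [cubeRoot] <;> ring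

theorem cubeRoot_sq_mul_im (α : Cyc12) : (cubeRoot * (cubeRoot * α)).im =
    ⟨-3 * α.re.im - 2 * α.im.re, -α.re.re - 2 * α.im.im⟩ := by
  ext <;> simp [cubeRoot] <;> ring

/-- Exactly one of `α`, `ζ₃ α`, `ζ₃² α` lies in ℤ[√3][i]. -/
def OneRotation (α : Cyc12) : Prop :=
  (2 ∣ α.im ∨ 2 ∣ (cubeRoot * α).im ∨ 2 ∣ (cubeRoot * (cubeRoot * α)).im) ∧
    ¬ (2 ∣ α.im ∧ 2 ∣ (cubeRoot * α).im) ∧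
    ¬ (2 ∣ α.im ∧ 2 ∣ (cubeRoot * (cubeRoot * α)).im) ∧
    ¬ (2 ∣ (cubeRoot * α).im ∧ 2 ∣ (cubeRoot * (cubeRoot * α)).im)

theorem not_even_three : ¬ Even (3 : ℤ) := by decide

theorem relNorm_re' (α : Cyc12) : (relNorm α).re =
    α.re.re ^ 2 + 3 * (α.re.re * α.im.im) + 3 * α.im.im ^ 2 +
      (α.im.re ^ 2 + 3 * (α.im.re * α.re.im) + 3 * α.re.im ^ 2) := by
  simp [relNorm_eq, sq]; ring

theorem relNorm_im (α : Cyc12) : (relNorm α).im =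
    2 * (α.re.re * α.re.im + α.im.re * α.im.im) + α.re.re * α.im.re + 3 * (α.re.im * α.im.im) := by
  simp [relNorm_eq, sq]; ring

theorem oneRotation_of_odd {α : Cyc12} (h : ¬ Even (relNorm α).re) : OneRotation α := by
  have := not_even_three
  rw [relNorm_re'] at h
  simp only [OneRotation, two_dvd_iff, cubeRoot_sq_mul_im]
  simp only [cubeRoot_mul_im]
  simp only [Int.even_add, Int.even_sub, Int.even_mul, Int.even_pow, even_neg, neg_mul, this,
    even_two] at h ⊢
  by_cases hp : Even α.re.re <;> by_cases hq : Even α.re.im <;>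
    by_cases hr : Even α.im.re <;> by_cases hs : Even α.im.im <;>
    simp only [hp, hq, hr, hs] at h ⊢ <;> simp at h ⊢

theorem oneRotation_pi2_mul {β : Cyc12} (h : ¬ Even ((relNorm β).re + (relNorm β).im)) :
    OneRotation (algebraMap _ Cyc12 pi2 * β) := by
  have := not_even_three
  rw [relNorm_re', relNorm_im] at h
  have hre (x : Zsqrtd 3) : (pi2 * x).re = x.re + 3 * x.im := by simp [pi2]
  have him (x : Zsqrtd 3) : (pi2 * x).im = x.im + x.re := by simp [pi2]
  simp only [OneRotation, two_dvd_iff, cubeRoot_sq_mul_im]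
  simp only [cubeRoot_mul_im, ← Algebra.smul_def, QuadraticAlgebra.re_smul,
    QuadraticAlgebra.im_smul, smul_eq_mul, hre, him]
  simp only [Int.even_add, Int.even_sub, Int.even_mul, Int.even_pow, even_neg, neg_mul, this,
    even_two] at h ⊢
  by_cases hp : Even β.re.re <;> by_cases hq : Even β.re.im <;>
    by_cases hr : Even β.im.re <;> by_cases hs : Even β.im.im <;>
    simp only [hp, hq, hr, hs] at h ⊢ <;> simp at h ⊢

theorem three_mul_r2 {ν : Zsqrtd 3} (h : ∀ α : Cyc12, relNorm α = ν → OneRotation α) :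
    normCount ν = 3 * r2 ν := by
  let T : Cyc12 → Set Cyc12 := fun z => {α : Cyc12 | relNorm α = ν ∧ 2 ∣ (z * α).im}
  have hT : ∀ z w : Cyc12, relNorm z = 1 → relNorm w = 1 → w * z = 1 → (T z).ncard = r2 ν := by
    intro z w hz hw hwz
    have hz0 : z ≠ 0 := right_ne_zero_of_mul_eq_one hwz
    rw [r2_eq_ncard, ← Set.ncard_image_of_injective _ (mul_right_injective₀ hz0)]
    congr 1
    ext α
    constructor
    · rintro ⟨β, hβ, rfl⟩
      exact ⟨by rw [map_mul, hz, one_mul]; exact hβ.1, hβ.2⟩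
    · rintro ⟨h1, h2⟩
      have e : z * (w * α) = α := by rw [← mul_assoc, mul_comm z, hwz, one_mul]
      exact ⟨w * α, ⟨by rw [map_mul, hw, one_mul, h1], by rwa [e]⟩, e⟩
  have hc := relNorm_cubeRoot
  have hcc : relNorm (cubeRoot * cubeRoot) = 1 := by rw [map_mul, hc, one_mul]
  have h0 := hT 1 1 (map_one _) (map_one _) (one_mul _)
  have h1 := hT _ _ hc hcc (by rw [mul_assoc, cubeRoot_pow_three])
  have h2 := hT _ _ hcc hc cubeRoot_pow_three
  have hfin : ∀ z, (T z).Finite := fun z => (finite_relNorm_eq ν).subset fun α hα => hα.1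
  have hun : {α : Cyc12 | relNorm α = ν} = T 1 ∪ (T cubeRoot ∪ T (cubeRoot * cubeRoot)) := by
    ext α
    constructor
    · intro hα
      rcases (h α hα).1 with h | h | h
      · exact .inl ⟨hα, by rwa [one_mul]⟩
      · exact .inr (.inl ⟨hα, h⟩)
      · exact .inr (.inr ⟨hα, by rwa [mul_assoc]⟩)
    · rintro (h | h | h) <;> exact h.1
  have hd1 : Disjoint (T cubeRoot) (T (cubeRoot * cubeRoot)) := by
    refine Set.disjoint_left.2 fun α ha hb => (h α ha.1).2.2.2 ⟨ha.2, ?_⟩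
    rw [← mul_assoc]; exact hb.2
  have hd2 : Disjoint (T 1) (T cubeRoot ∪ T (cubeRoot * cubeRoot)) := by
    refine Set.disjoint_left.2 fun α ha hb => ?_
    have ha2 : 2 ∣ α.im := by rw [← one_mul α]; exact ha.2
    rcases hb with hb | hb
    · exact (h α ha.1).2.1 ⟨ha2, hb.2⟩
    · exact (h α ha.1).2.2.1 ⟨ha2, by rw [← mul_assoc]; exact hb.2⟩
  rw [normCount, hun, Set.ncard_union_eq hd2 (hfin _) ((hfin _).union (hfin _)),
    Set.ncard_union_eq hd1 (hfin _) (hfin _), h0, h1, h2]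
  ring

theorem algebraMap_pi2_dvd (α : Cyc12) (h : pi2 ∣ relNorm α) : algebraMap _ Cyc12 pi2 ∣ α := by
  have := not_even_three
  rw [pi2_dvd_iff, relNorm_re', relNorm_im] at h
  rw [QuadraticAlgebra.algebraMap_dvd_iff, pi2_dvd_iff, pi2_dvd_iff]
  simp [parity_simps, this] at h ⊢
  tauto

/-- Let ν = a + b√3 be totally positive and let v be the exponent of
𝔭₂ in (ν). If v = 0 and b is even, or v = 2, then r_{2,K}(ν) = 4·σ_{0,χ}(ν). -/
theorem two_squares_count_low (ν : Zsqrtd 3) (v : ℕ) (hpos : TotPos ν)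
    (hv1 : p2 ^ v ∣ Ideal.span {ν}) (hv2 : ¬ p2 ^ (v + 1) ∣ Ideal.span {ν})
    (h : (v = 0 ∧ Even ν.im) ∨ v = 2) :
    (r2 ν : ℤ) = 4 * sigmaChi ν := by
  rw [p2, Ideal.span_singleton_pow, Ideal.span_singleton_dvd_span_singleton_iff_dvd] at hv1 hv2
  rcases h with ⟨rfl, heven⟩ | rfl
  · rw [zero_add, pow_one, pi2_dvd_iff] at hv2
    have hre : ¬ Even ν.re := fun h => hv2 (h.add heven)
    have h1 := normCount_eq ν hpos (by rwa [even_norm_iff])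
    have h2 := three_mul_r2 (ν := ν) (by rintro α rfl; exact oneRotation_of_odd hre)
    zify at h2
    linarith
  · obtain ⟨μ, rfl⟩ := hv1
    rw [pow_succ, mul_dvd_mul_iff_left (pow_ne_zero 2 prime_pi2.ne_zero), pi2_dvd_iff] at hv2
    rw [sq, mul_assoc] at hpos ⊢
    have hμ : TotPos μ := by
      rw [← mul_assoc] at hpos
      exact hpos.of_mul_left (totPos_sq prime_pi2.ne_zero)
    have h1 := normCount_eq μ hμ (by rwa [even_norm_iff])
    have h2 := three_mul_r2 (ν := pi2 * (pi2 * μ)) (by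
      intro α hα
      obtain ⟨β, rfl⟩ := algebraMap_pi2_dvd α ⟨_, hα⟩
      rw [map_mul, QuadraticAlgebra.norm_algebraMap, sq, mul_assoc] at hα
      have hβ := mul_left_cancel₀ prime_pi2.ne_zero (mul_left_cancel₀ prime_pi2.ne_zero hα)
      exact oneRotation_pi2_mul (by rwa [hβ]))
    rw [normCount_mul_of_forall_dvd prime_pi2.ne_zero μ algebraMap_pi2_dvd] at h2
    rw [sigmaChi_pi2_mul (mul_ne_zero prime_pi2.ne_zero hμ.ne_zero), sigmaChi_pi2_mul hμ.ne_zero]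
    zify at h2
    linarith

end Paper3
end
end

section
/- Let ν ∈ O_K be totally positive with π₂⁴ ∣ ν, and assume ν is a sum of two squares in O_K. Then there exist x₁, x₂ ∈ O_K with π₂ ∣ x₁, π₂ ∣ x₂ and x₁² + x₂² = ν. -/
/-!
Statements about sums of squares in K = ℚ(√3), with ring of integers O_K = ℤ[√3],
realized as `Zsqrtd 3`.
-/

noncomputable section

namespace Paper3

theorem four_dvd_re_of_pi2_pow_four_dvd {x : Zsqrtd 3} (h : pi2 ^ 4 ∣ x) : 4 ∣ x.re := by
  obtain ⟨y, rfl⟩ := h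
  refine ⟨7 * y.re + 12 * y.im, ?_⟩
  simp [pi2, pow_succ]
  ring

/-- Multiplying `u + i w` by the twelfth root of unity `(√3 + i) / 2` makes both coordinates
divisible by `pi2`, under congruence conditions on the coordinates. -/
theorem exists_even_of_congr (u w : Zsqrtd 3) (hu : Even u.im) (hw : Even w.re)
    (had : Even (u.re + w.im)) (h : 4 ∣ u.re + u.im + w.re - w.im) :
    ∃ x₁ x₂ : Zsqrtd 3, pi2 ∣ x₁ ∧ pi2 ∣ x₂ ∧ x₁ ^ 2 + x₂ ^ 2 = u ^ 2 + w ^ 2 := by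
  obtain ⟨a, b⟩ := u
  obtain ⟨c, d⟩ := w
  obtain ⟨b, rfl⟩ := hu
  obtain ⟨c, rfl⟩ := hw
  obtain ⟨e, he⟩ := had
  obtain ⟨k, hk⟩ := h
  dsimp only at he hk
  obtain rfl : a = 2 * e - d := by lia
  refine ⟨⟨3 * b - c, e - d⟩, ⟨e + d, b + c⟩, (pi2_dvd_iff _).2 ⟨k + b - c, by grind⟩,
    (pi2_dvd_iff _).2 ⟨k + d, by grind⟩, ?_⟩
  ext <;> simp [pow_two] <;> ring

/-- If ν is totally positive, π₂⁴ ∣ ν, and ν is a sum of two squares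
in O_K, then there exist x₁, x₂ ∈ 𝔭₂ with x₁² + x₂² = ν. -/
theorem even_representation (ν : Zsqrtd 3) (hpos : TotPos ν) (hdvd : pi2 ^ 4 ∣ ν)
    (hrep : ∃ u w : Zsqrtd 3, u ^ 2 + w ^ 2 = ν) :
    ∃ x₁ x₂ : Zsqrtd 3, pi2 ∣ x₁ ∧ pi2 ∣ x₂ ∧ x₁ ^ 2 + x₂ ^ 2 = ν := by
  have h4 := four_dvd_re_of_pi2_pow_four_dvd hdvd
  obtain ⟨u, w, rfl⟩ := hrep
  have hre : (u ^ 2 + w ^ 2).re = u.re ^ 2 + 3 * u.im ^ 2 + (w.re ^ 2 + 3 * w.im ^ 2) := by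
    simp [pow_two]
    ring
  rw [hre] at h4
  have sq_mod (n : ℤ) : Even n ∧ 4 ∣ n ^ 2 ∨ Odd n ∧ 4 ∣ n ^ 2 - 1 := by
    rcases Int.even_or_odd n with ⟨k, rfl⟩ | ⟨k, rfl⟩
    · exact .inl ⟨⟨k, rfl⟩, k ^ 2, by ring⟩
    · exact .inr ⟨⟨k, rfl⟩, k ^ 2 + k, by ring⟩
  have of_parity (u w : Zsqrtd 3) (ha : Odd u.re) (hb : Even u.im) (hc : Even w.re)
      (hd : Odd w.im) : ∃ x₁ x₂ : Zsqrtd 3,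
        pi2 ∣ x₁ ∧ pi2 ∣ x₂ ∧ x₁ ^ 2 + x₂ ^ 2 = u ^ 2 + w ^ 2 := by
    by_cases h : 4 ∣ u.re + u.im + w.re - w.im
    · exact exists_even_of_congr u w hb hc (ha.add_odd hd) h
    · rw [← neg_sq w]
      refine exists_even_of_congr u (-w) hb (by simpa using hc)
        (by simpa using ha.add_odd hd.neg) ?_
      simp only [Zsqrtd.re_neg, Zsqrtd.im_neg]
      grind
  by_cases hdvd_uw : pi2 ∣ u ∧ pi2 ∣ w
  · exact ⟨u, w, hdvd_uw.1, hdvd_uw.2, rfl⟩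
  rw [pi2_dvd_iff, pi2_dvd_iff] at hdvd_uw
  rcases sq_mod u.re with ⟨ha, ha'⟩ | ⟨ha, ha'⟩ <;>
  rcases sq_mod u.im with ⟨hb, hb'⟩ | ⟨hb, hb'⟩ <;>
  rcases sq_mod w.re with ⟨hc, hc'⟩ | ⟨hc, hc'⟩ <;>
  rcases sq_mod w.im with ⟨hd, hd'⟩ | ⟨hd, hd'⟩ <;>
  first
  | exact of_parity u w ha hb hc hd
  | (rw [add_comm (u ^ 2)]; exact of_parity w u hc hd ha hb)
  | grind

end Paper3
end
end
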